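/- Let Ω ⊆ ℝⁿ be an open bounded convex set and let u : Ω → ℝ be a bounded continuous function that is semiconcave with constant C ≥ 0 on Ω, i.e. u(λx + (1−λ)y) ≥ λu(x) + (1−λ)u(y) − C·λ(1−λ)|x−y|²/2 for every segment [x,y] ⊂ Ω and λ ∈ [0,1]. Fix ε ∈ (0, 1/C) (any ε > 0 if C = 0) and set ρ(ε) := 2√(ε·sup_Ω |u|) and A_ε := {x ∈ Ω : dist(x, ∂Ω) > ρ(ε)}. Then the sup-convolution u^ε is differentiable at every point of A_ε and its gradient ∇u^ε is Lipschitz continuous on every compact subset of A_ε. -/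

import Mathlib

open Set Metric

/-- The sup-convolution `u^ε` of a function `u : Ω → ℝ`. -/
noncomputable def supConv {n : ℕ} (ε : ℝ) (Ω : Set (EuclideanSpace ℝ (Fin n)))
    (u : EuclideanSpace ℝ (Fin n) → ℝ) (x : EuclideanSpace ℝ (Fin n)) : ℝ :=
  sSup ((fun y => u y - ‖x - y‖ ^ 2 / (2 * ε)) '' Ω)

/-- The radius `ρ(ε) = 2 √(ε ⬝ sup_Ω |u|)`. -/
noncomputable def rho {n : ℕ} (ε : ℝ) (Ω : Set (EuclideanSpace ℝ (Fin n)))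
    (u : EuclideanSpace ℝ (Fin n) → ℝ) : ℝ :=
  2 * Real.sqrt (ε * sSup ((fun y => |u y|) '' Ω))

open scoped RealInnerProductSpace

section QuadraticGradient

variable {E : Type*} [NormedAddCommGroup E] [InnerProductSpace ℝ E]

/-- `f` lies within `K ‖z - x‖ ^ 2` of the affine function through `(x, f x)` with slope `p`. -/
def HasQuadraticGradientAt (K : ℝ) (f : E → ℝ) (p x : E) : Prop :=
  ∀ z, |f z - f x - ⟪p, z - x⟫| ≤ K * ‖z - x‖ ^ 2

theorem HasQuadraticGradientAt.hasGradientAt [CompleteSpace E] {K : ℝ} {f : E → ℝ} {p x : E}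
    (h : HasQuadraticGradientAt K f p x) : HasGradientAt f p x := by
  rw [hasGradientAt_iff_isLittleO]
  have h₁ : (fun z => f z - f x - ⟪p, z - x⟫) =O[nhds x] fun z => ‖z - x‖ ^ 2 :=
    Asymptotics.IsBigO.of_bound K (Filter.Eventually.of_forall fun z => by
      simpa using h z)
  have h₂ : Filter.Tendsto (fun z => z - x) (nhds x) (nhds 0) :=
    tendsto_sub_nhds_zero_iff.2 Filter.tendsto_id
  exact h₁.trans_isLittleO
    ((Asymptotics.isLittleO_norm_pow_id one_lt_two).comp_tendsto h₂)

theorem HasQuadraticGradientAt.norm_sub_le [CompleteSpace E] {K : ℝ} (hK : 0 ≤ K) {f : E → ℝ}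
    {p q x y : E} (hp : HasQuadraticGradientAt K f p x) (hq : HasQuadraticGradientAt K f q y) :
    ‖p - q‖ ≤ 6 * K * ‖x - y‖ := by
  rcases eq_or_ne x y with rfl | hxy
  · rw [hp.hasGradientAt.unique hq.hasGradientAt]
    simp
  rcases eq_or_ne p q with rfl | hpq
  · rw [sub_self, norm_zero]
    positivity
  have hs : 0 < ‖p - q‖ := norm_pos_iff.2 (sub_ne_zero.2 hpq)
  set r := ‖x - y‖ with hr
  have hr₀ : 0 < r := norm_pos_iff.2 (sub_ne_zero.2 hxy)
  -- compare the two expansions at the point at distance `r` from `y` in the direction `p - q`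
  set v : E := (r / ‖p - q‖) • (p - q) with hv
  have hvn : ‖v‖ = r := by
    rw [hv, norm_smul, Real.norm_of_nonneg (by positivity)]
    field_simp
  have h₁ := abs_le.1 (hp (y + v))
  have h₂ := abs_le.1 (hp y)
  have h₃ := abs_le.1 (hq (y + v))
  have e₁ : ⟪p, y + v - x⟫ = ⟪p, y - x⟫ + ⟪p, v⟫ := by
    rw [← inner_add_right]
    congr 1
    abel
  have e₂ : ⟪p, v⟫ - ⟪q, v⟫ = r * ‖p - q‖ := by
    rw [← inner_sub_left, hv, inner_smul_right, real_inner_self_eq_norm_sq]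
    field_simp
  have e₃ : ‖y + v - x‖ ≤ 2 * r := by
    calc ‖y + v - x‖ = ‖(y - x) + v‖ := by congr 1; abel
      _ ≤ ‖y - x‖ + ‖v‖ := norm_add_le _ _
      _ = 2 * r := by rw [hvn, norm_sub_rev]; ring
  have e₄ : K * ‖y + v - x‖ ^ 2 ≤ K * (2 * r) ^ 2 := by gcongr
  rw [add_sub_cancel_left, hvn] at h₃
  rw [norm_sub_rev y x, ← hr] at h₂
  refine le_of_mul_le_mul_left ?_ hr₀
  linarith [h₁.2, h₂.1, h₃.1]

end QuadraticGradient

section SupConv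

variable {n : ℕ} {ε : ℝ} {Ω : Set (EuclideanSpace ℝ (Fin n))} {u : EuclideanSpace ℝ (Fin n) → ℝ}

theorem bddAbove_supConv (hε : 0 ≤ ε) {M : ℝ} (hM : ∀ y ∈ Ω, |u y| ≤ M)
    (x : EuclideanSpace ℝ (Fin n)) :
    BddAbove ((fun y => u y - ‖x - y‖ ^ 2 / (2 * ε)) '' Ω) := by
  refine ⟨M, ?_⟩
  rintro _ ⟨y, hy, rfl⟩
  have h : 0 ≤ ‖x - y‖ ^ 2 / (2 * ε) := by positivity
  have := (abs_le.1 (hM y hy)).2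
  dsimp only
  linarith

theorem le_supConv (hε : 0 ≤ ε) {M : ℝ} (hM : ∀ y ∈ Ω, |u y| ≤ M)
    (x : EuclideanSpace ℝ (Fin n)) {y : EuclideanSpace ℝ (Fin n)} (hy : y ∈ Ω) :
    u y - ‖x - y‖ ^ 2 / (2 * ε) ≤ supConv ε Ω u x :=
  le_csSup (bddAbove_supConv hε hM x) ⟨y, hy, rfl⟩

/-- The points at distance more than `r ≥ 0` from `∂Ω` are centres of closed balls in `Ω`. -/
theorem closedBall_subset_of_lt_infDist_frontier {E : Type*} [NormedAddCommGroup E]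
    [NormedSpace ℝ E] {s : Set E} {x : E} {r : ℝ} (hr : 0 ≤ r) (hx : x ∈ s)
    (h : r < infDist x (frontier s)) : closedBall x r ⊆ s := by
  have hcover : closedBall x r ⊆ interior s ∪ interior sᶜ := by
    rw [← compl_frontier_eq_union_interior]
    intro w hw hwf
    rw [mem_closedBall'] at hw
    exact (h.trans_le (infDist_le_dist_of_mem hwf)).not_ge hw
  have hxr := mem_closedBall_self (x := x) hr
  have hxi : x ∈ interior s :=
    (hcover hxr).resolve_right fun h' => interior_subset h' hx
  exact ((convex_closedBall x r).isPreconnected.subset_left_of_subset_union isOpen_interior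
    isOpen_interior (disjoint_compl_right.mono interior_subset interior_subset) hcover
    ⟨x, hxr, hxi⟩).trans interior_subset

theorem exists_supConv_eq (hε : 0 < ε) (hu : ContinuousOn u Ω) {M : ℝ}
    (hM : ∀ y ∈ Ω, |u y| ≤ M) {x : EuclideanSpace ℝ (Fin n)} (hx : x ∈ Ω)
    (hxd : rho ε Ω u < infDist x (frontier Ω)) :
    ∃ y ∈ Ω, supConv ε Ω u x = u y - ‖x - y‖ ^ 2 / (2 * ε) := by
  have hr : 0 ≤ rho ε Ω u := by unfold rho; positivity
  have hsub := closedBall_subset_of_lt_infDist_frontier hr hx hxd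
  have hcont : ContinuousOn (fun y => u y - ‖x - y‖ ^ 2 / (2 * ε)) (closedBall x (rho ε Ω u)) :=
    (hu.mono hsub).sub (by fun_prop)
  obtain ⟨y, hy, hmax⟩ := (isCompact_closedBall x (rho ε Ω u)).exists_isMaxOn
    ⟨x, mem_closedBall_self hr⟩ hcont
  refine ⟨y, hsub hy, le_antisymm (csSup_le ⟨_, x, hx, rfl⟩ ?_) (le_supConv hε.le hM x (hsub hy))⟩
  rintro _ ⟨z, hz, rfl⟩
  by_cases hzb : z ∈ closedBall x (rho ε Ω u)
  · exact hmax hzb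
  have hxy : u x - ‖x - x‖ ^ 2 / (2 * ε) ≤ u y - ‖x - y‖ ^ 2 / (2 * ε) :=
    hmax (mem_closedBall_self hr)
  refine le_trans ?_ hxy
  set S := sSup ((fun y => |u y|) '' Ω) with hS
  have hle : ∀ w ∈ Ω, |u w| ≤ S := fun w hw =>
    le_csSup ⟨M, by rintro _ ⟨w, hw, rfl⟩; exact hM w hw⟩ ⟨w, hw, rfl⟩
  have hS₀ : 0 ≤ S := (abs_nonneg _).trans (hle x hx)
  rw [mem_closedBall, dist_comm, dist_eq_norm, not_le] at hzb
  have hsq : rho ε Ω u ^ 2 = 2 * S * (2 * ε) := by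
    rw [rho, mul_pow, Real.sq_sqrt (by positivity)]
    ring
  have h₁ : 2 * S ≤ ‖x - z‖ ^ 2 / (2 * ε) := by
    rw [le_div_iff₀ (by positivity), ← hsq]
    gcongr
  have h₂ := (abs_le.1 (hle z hz)).2
  have h₃ := (abs_le.1 (hle x hx)).1
  rw [sub_self, norm_zero, zero_pow two_ne_zero, zero_div, sub_zero]
  linarith

theorem mul_add_sq_le {ε C : ℝ} (hε : 0 < ε) (hεC : ε * C < 1) (a b : ℝ) :
    C * (a + b) ^ 2 ≤ C / (1 - ε * C) * a ^ 2 + b ^ 2 / ε := by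
  have hδ : 0 < 1 - ε * C := by linarith
  rw [div_mul_eq_mul_div, div_add_div _ _ hδ.ne' hε.ne', le_div_iff₀ (by positivity)]
  linarith [sq_nonneg (ε * C * a - (1 - ε * C) * b)]

theorem supConv_add_add_supConv_sub_le (hΩ : Convex ℝ Ω) (hne : Ω.Nonempty) {M : ℝ}
    (hM : ∀ y ∈ Ω, |u y| ≤ M) {C : ℝ} (hC : 0 ≤ C)
    (hsc : ∀ x ∈ Ω, ∀ y ∈ Ω, ∀ l ∈ Set.Icc (0:ℝ) 1,
      l * u x + (1 - l) * u y - C * (l * (1 - l)) / 2 * ‖x - y‖ ^ 2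
        ≤ u (l • x + (1 - l) • y))
    (hε : 0 < ε) (hεC : ε * C < 1) (x h : EuclideanSpace ℝ (Fin n)) :
    supConv ε Ω u (x + h) + supConv ε Ω u (x - h)
      ≤ 2 * supConv ε Ω u x + C / (1 - ε * C) * ‖h‖ ^ 2 := by
  have key : ∀ y ∈ Ω, ∀ z ∈ Ω,
      (u y - ‖x + h - y‖ ^ 2 / (2 * ε)) + (u z - ‖x - h - z‖ ^ 2 / (2 * ε))
        ≤ 2 * supConv ε Ω u x + C / (1 - ε * C) * ‖h‖ ^ 2 := by
    intro y hy z hz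
    have hhalf : (1 / 2 : ℝ) ∈ Icc (0 : ℝ) 1 := by norm_num
    have hm : (1 / 2 : ℝ) • y + (1 - 1 / 2 : ℝ) • z ∈ Ω :=
      hΩ hy hz (by norm_num) (by norm_num) (by norm_num)
    have h₁ := hsc y hy z hz (1 / 2) hhalf
    have h₂ := le_supConv hε.le hM x hm
    set a := x + h - y with ha
    set b := x - h - z with hb
    set e := a - b with he
    have hmid : x - ((1 / 2 : ℝ) • y + (1 - 1 / 2 : ℝ) • z) = (1 / 2 : ℝ) • (a + b) := by
      rw [ha, hb]
      module
    have hpar : ‖a + b‖ ^ 2 + ‖e‖ ^ 2 = 2 * (‖a‖ ^ 2 + ‖b‖ ^ 2) := by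
      have := parallelogram_law_with_norm ℝ a b
      rw [he]
      linarith
    have hd : ‖y - z‖ ≤ 2 * ‖h‖ + ‖e‖ := by
      have : y - z = (2 : ℝ) • h - e := by
        rw [he, ha, hb]
        module
      rw [this]
      refine (norm_sub_le _ _).trans_eq ?_
      rw [norm_smul]
      norm_num
    have hd₂ : C * ‖y - z‖ ^ 2 ≤ C * (2 * ‖h‖ + ‖e‖) ^ 2 := by gcongr
    rw [hmid, norm_smul, mul_pow, Real.norm_of_nonneg (by norm_num)] at h₂
    have hsq := mul_add_sq_le hε hεC (2 * ‖h‖) ‖e‖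
    have hpar' : ‖a‖ ^ 2 / (2 * ε) + ‖b‖ ^ 2 / (2 * ε)
        = 2 * ((1 / 2) ^ 2 * ‖a + b‖ ^ 2 / (2 * ε)) + ‖e‖ ^ 2 / ε / 4 := by
      field_simp
      linarith
    linarith
  have hz : ∀ z ∈ Ω, supConv ε Ω u (x + h) ≤ 2 * supConv ε Ω u x + C / (1 - ε * C) * ‖h‖ ^ 2
      - (u z - ‖x - h - z‖ ^ 2 / (2 * ε)) := by
    intro z hz
    refine csSup_le (hne.image _) ?_
    rintro _ ⟨y, hy, rfl⟩
    exact le_sub_iff_add_le.2 (key y hy z hz)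
  rw [← le_sub_iff_add_le']
  refine csSup_le (hne.image _) ?_
  rintro _ ⟨z, hz', rfl⟩
  have := hz z hz'
  dsimp only
  linarith

theorem exists_hasQuadraticGradientAt_supConv (hΩ : Convex ℝ Ω) (hu : ContinuousOn u Ω) {M : ℝ}
    (hM : ∀ y ∈ Ω, |u y| ≤ M) {C : ℝ} (hC : 0 ≤ C)
    (hsc : ∀ x ∈ Ω, ∀ y ∈ Ω, ∀ l ∈ Set.Icc (0:ℝ) 1,
      l * u x + (1 - l) * u y - C * (l * (1 - l)) / 2 * ‖x - y‖ ^ 2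
        ≤ u (l • x + (1 - l) • y))
    (hε : 0 < ε) (hεC : ε * C < 1) {x : EuclideanSpace ℝ (Fin n)} (hx : x ∈ Ω)
    (hxd : rho ε Ω u < infDist x (frontier Ω)) :
    ∃ p, HasQuadraticGradientAt (1 / (2 * ε) + C / (1 - ε * C)) (supConv ε Ω u) p x := by
  have hδ : 0 < 1 - ε * C := by linarith
  obtain ⟨y, hy, hxy⟩ := exists_supConv_eq hε hu hM hx hxd
  -- the paraboloid with vertex over the maximizer `y` touches `u^ε` from below at `x`
  have hlow : ∀ z, supConv ε Ω u x + ⟪ε⁻¹ • (y - x), z - x⟫ - 1 / (2 * ε) * ‖z - x‖ ^ 2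
      ≤ supConv ε Ω u z := by
    intro z
    refine le_trans (le_of_eq ?_) (le_supConv hε.le hM z hy)
    have : ‖z - y‖ ^ 2 = ‖z - x‖ ^ 2 - 2 * ⟪y - x, z - x⟫ + ‖x - y‖ ^ 2 := by
      rw [norm_sub_rev x y, real_inner_comm, ← norm_sub_sq_real]
      congr 2
      abel
    rw [hxy, this, real_inner_smul_left]
    field_simp
    ring
  refine ⟨ε⁻¹ • (y - x), fun z => abs_le.2 ⟨?_, ?_⟩⟩
  · have := hlow z
    have : 0 ≤ C / (1 - ε * C) * ‖z - x‖ ^ 2 := by positivity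
    linarith
  · have h₁ := supConv_add_add_supConv_sub_le hΩ ⟨x, hx⟩ hM hC hsc hε hεC x (z - x)
    have h₂ := hlow (x - (z - x))
    rw [add_sub_cancel] at h₁
    rw [sub_sub_cancel_left, inner_neg_right, norm_neg] at h₂
    linarith

end SupConv

theorem supConv_C11_of_semiconcave
    {n : ℕ} (Ω : Set (EuclideanSpace ℝ (Fin n)))
    (hΩopen : IsOpen Ω) (hΩbdd : Bornology.IsBounded Ω) (hΩconv : Convex ℝ Ω)
    (u : EuclideanSpace ℝ (Fin n) → ℝ)
    (hu : ContinuousOn u Ω) (hubdd : ∃ M : ℝ, ∀ y ∈ Ω, |u y| ≤ M)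
    (C : ℝ) (hC : 0 ≤ C)
    (hsc : ∀ x ∈ Ω, ∀ y ∈ Ω, ∀ l ∈ Set.Icc (0:ℝ) 1,
      l * u x + (1 - l) * u y - C * (l * (1 - l)) / 2 * ‖x - y‖ ^ 2
        ≤ u (l • x + (1 - l) • y))
    (ε : ℝ) (hε : 0 < ε) (hεC : ε * C < 1) :
    (∀ x ∈ {x ∈ Ω | rho ε Ω u < Metric.infDist x (frontier Ω)},
        DifferentiableAt ℝ (supConv ε Ω u) x) ∧
    (∀ K ⊆ {x ∈ Ω | rho ε Ω u < Metric.infDist x (frontier Ω)}, IsCompact K →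
        ∃ L : NNReal, LipschitzOnWith L (fun x => gradient (supConv ε Ω u) x) K) := by
  obtain ⟨M, hM⟩ := hubdd
  have hgrad := fun x (hx : x ∈ {x ∈ Ω | rho ε Ω u < Metric.infDist x (frontier Ω)}) =>
    exists_hasQuadraticGradientAt_supConv hΩconv hu hM hC hsc hε hεC hx.1 hx.2
  refine ⟨fun x hx => ?_, fun K hK _ => ?_⟩
  · obtain ⟨p, hp⟩ := hgrad x hx
    exact hp.hasGradientAt.differentiableAt
  · have hδ : 0 < 1 - ε * C := by linarith
    have hL : 0 ≤ 1 / (2 * ε) + C / (1 - ε * C) := by positivity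
    refine ⟨⟨6 * (1 / (2 * ε) + C / (1 - ε * C)), by positivity⟩,
      LipschitzOnWith.of_dist_le_mul fun x hx y hy => ?_⟩
    obtain ⟨p, hp⟩ := hgrad x (hK hx)
    obtain ⟨q, hq⟩ := hgrad y (hK hy)
    rw [hp.hasGradientAt.gradient, hq.hasGradientAt.gradient, dist_eq_norm, dist_eq_norm]
    exact hp.norm_sub_le hL hq
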